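/- arXiv:2309.01996 — 2 statements merged into one kernel-verified Lean document; each statement's English description precedes it below -/
import Mathlib

section
/- Let f = u + iv be a holomorphic function on the open unit disc 𝔻 ⊂ ℂ (u = Re f, v = Im f) with v(0) = 0, and let 1 < p < ∞. There exists a constant C_p > 0 depending only on p such that sup_{0<r<1} ∫₀^{2π} |f(r e^{iθ})|^p dθ ≤ C_p^p · sup_{0<r<1} ∫₀^{2π} |u(r e^{iθ})|^p dθ. In particular, if the right-hand side is finite (i.e. u ∈ h^p), then f ∈ H^p. -/
open Real MeasureTheory Set

lemma rz_hasDerivAt_integral (g g' : ℝ → ℝ → ℝ)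
    (hg : ContinuousOn (Function.uncurry g) (Iio 0 ×ˢ univ))
    (hg' : ContinuousOn (Function.uncurry g') (Iio 0 ×ˢ univ))
    (hd : ∀ t < 0, ∀ θ, HasDerivAt (fun s => g s θ) (g' t θ) t) (t : ℝ) (ht : t < 0) :
    HasDerivAt (fun s => ∫ θ in (0:ℝ)..(2*π), g s θ) (∫ θ in (0:ℝ)..(2*π), g' t θ) t := by
  have hcont : ∀ (h : ℝ → ℝ → ℝ), ContinuousOn (Function.uncurry h) (Iio 0 ×ˢ univ) →
      ∀ s < 0, Continuous (h s) := by
    intro h hh s hs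
    have : Continuous ((Function.uncurry h) ∘ (fun θ : ℝ => (s, θ))) := by
      rw [← continuousOn_univ]
      refine hh.comp (by fun_prop) ?_
      intro θ _
      exact ⟨hs, mem_univ _⟩
    exact this
  have hK : IsCompact (Icc (2*t) (t/2) ×ˢ Icc (0:ℝ) (2*π)) := isCompact_Icc.prod isCompact_Icc
  obtain ⟨B, hB⟩ := hK.exists_bound_of_continuousOn (hg'.mono (by
    rintro ⟨a, b⟩ ⟨h1, h2⟩
    exact ⟨by simp at h1 ⊢; linarith [h1.2], mem_univ _⟩))
  have hnhds : Icc (2*t) (t/2) ∈ nhds t := Icc_mem_nhds (by linarith) (by linarith)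
  refine (intervalIntegral.hasDerivAt_integral_of_dominated_loc_of_deriv_le
    (F := g) (F' := g') (bound := fun _ => B) (s := Icc (2*t) (t/2)) hnhds ?_ ?_ ?_ ?_ ?_ ?_).2
  · filter_upwards [Iio_mem_nhds ht] with s hs
    exact (hcont g hg s hs).aestronglyMeasurable
  · exact (hcont g hg t ht).intervalIntegrable _ _
  · exact (hcont g' hg' t ht).aestronglyMeasurable
  · refine Filter.Eventually.of_forall fun θ hθ s hs => ?_
    rw [uIoc_of_le (by positivity)] at hθ
    exact hB (s, θ) ⟨hs, hθ.1.le, hθ.2⟩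
  · exact intervalIntegrable_const
  · refine Filter.Eventually.of_forall fun θ hθ s hs => ?_
    exact hd s (by linarith [hs.2]) θ

lemma rz_submean (Φ : ℂ → ℝ) (hΦ : ContDiff ℝ 2 Φ)
    (lap : ∀ w a : ℂ, 0 ≤ fderiv ℝ (fderiv ℝ Φ) w a a
      + fderiv ℝ (fderiv ℝ Φ) w (a * Complex.I) (a * Complex.I))
    (f : ℂ → ℂ) (hf : DifferentiableOn ℂ f (Metric.ball 0 1)) (r : ℝ) (hr0 : 0 < r) (hr1 : r < 1) :
    2 * π * Φ (f 0) ≤ ∫ θ in (0:ℝ)..(2*π), Φ (f ((r : ℂ) * Complex.exp (θ * Complex.I))) := by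
  set U : Set ℂ := {z | z.re < 0} with hU
  have hUo : IsOpen U := isOpen_lt Complex.continuous_re continuous_const
  have hexp : ∀ z ∈ U, Complex.exp z ∈ Metric.ball (0:ℂ) 1 := by
    intro z hz
    simp [Complex.norm_exp]
    exact hz
  set F : ℂ → ℂ := fun z => f (Complex.exp z) with hF
  have hFd : DifferentiableOn ℂ F U :=
    hf.comp Complex.differentiable_exp.differentiableOn hexp
  have hF1d : DifferentiableOn ℂ (deriv F) U := hFd.deriv hUo
  have hF2d : DifferentiableOn ℂ (deriv (deriv F)) U := hF1d.deriv hUo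
  have hder : ∀ G : ℂ → ℂ, DifferentiableOn ℂ G U → ∀ z ∈ U, HasDerivAt G (deriv G z) z :=
    fun G hG z hz => (hG.differentiableAt (hUo.mem_nhds hz)).hasDerivAt
  let ζ : ℝ → ℝ → ℂ := fun t θ => (t:ℂ) + θ * Complex.I
  have hζU : ∀ t < 0, ∀ θ, ζ t θ ∈ U := by
    intro t ht θ
    simp [ζ, hU, ht]
  have hζc : Continuous (Function.uncurry ζ) := by
    unfold ζ Function.uncurry; fun_prop
  have hζm : MapsTo (Function.uncurry ζ) (Iio 0 ×ˢ univ) U := by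
    rintro ⟨t, θ⟩ ⟨h, _⟩
    exact hζU t h θ
  have hζ1 : ∀ t θ, HasDerivAt (fun s => ζ s θ) 1 t := by
    intro t θ
    exact (Complex.ofRealCLM.hasDerivAt (x := t)).add_const _
  have hζ2 : ∀ t θ, HasDerivAt (fun s => ζ t s) Complex.I θ := by
    intro t θ
    have := ((Complex.ofRealCLM.hasDerivAt (x := θ)).mul_const Complex.I).const_add (t:ℂ)
    exact this.congr_deriv (by simp)
  have hG1 : ∀ G : ℂ → ℂ, DifferentiableOn ℂ G U → ∀ t < 0, ∀ θ,
      HasDerivAt (fun s => G (ζ s θ)) (deriv G (ζ t θ)) t := by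
    intro G hG t ht θ
    have := (hder G hG _ (hζU t ht θ)).comp (𝕜 := ℝ) t (hζ1 t θ)
    rw [mul_one] at this
    exact this
  have hG2 : ∀ G : ℂ → ℂ, DifferentiableOn ℂ G U → ∀ t < 0, ∀ θ,
      HasDerivAt (fun s => G (ζ t s)) (deriv G (ζ t θ) * Complex.I) θ := by
    intro G hG t ht θ
    exact (hder G hG _ (hζU t ht θ)).comp (𝕜 := ℝ) θ (hζ2 t θ)
  have hGc : ∀ G : ℂ → ℂ, DifferentiableOn ℂ G U →
      ContinuousOn (fun x : ℝ × ℝ => G (Function.uncurry ζ x)) (Iio 0 ×ˢ univ) := by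
    intro G hG
    exact hG.continuousOn.comp hζc.continuousOn hζm
  have hΦ1 : ContDiff ℝ 1 (fderiv ℝ Φ) := hΦ.fderiv_right (by norm_num)
  have hΦ0 : Differentiable ℝ Φ := hΦ.differentiable (by norm_num)
  have hΦ1d : Differentiable ℝ (fderiv ℝ Φ) := hΦ1.differentiable (by norm_num)
  have hΦ1c : Continuous (fderiv ℝ Φ) := hΦ1.continuous
  have hΦ2c : Continuous (fderiv ℝ (fderiv ℝ Φ)) := hΦ1.continuous_fderiv (by norm_num)
  have hch1 : ∀ (w : ℝ → ℂ) (w' : ℂ) (t : ℝ), HasDerivAt w w' t →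
      HasDerivAt (fun s => Φ (w s)) (fderiv ℝ Φ (w t) w') t := by
    intro w w' t hw
    exact (hΦ0 (w t)).hasFDerivAt.comp_hasDerivAt t hw
  have hch2 : ∀ (w b : ℝ → ℂ) (w' b' : ℂ) (t : ℝ), HasDerivAt w w' t → HasDerivAt b b' t →
      HasDerivAt (fun s => fderiv ℝ Φ (w s) (b s))
        (fderiv ℝ (fderiv ℝ Φ) (w t) w' (b t) + fderiv ℝ Φ (w t) b') t := by
    intro w b w' b' t hw hb
    exact ((hΦ1d (w t)).hasFDerivAt.comp_hasDerivAt t hw).clm_apply hb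
  set F1 := deriv F with hF1
  set F2 := deriv F1 with hF2
  let g0 : ℝ → ℝ → ℝ := fun t θ => Φ (F (ζ t θ))
  let g1 : ℝ → ℝ → ℝ := fun t θ => fderiv ℝ Φ (F (ζ t θ)) (F1 (ζ t θ))
  let g2 : ℝ → ℝ → ℝ := fun t θ => fderiv ℝ (fderiv ℝ Φ) (F (ζ t θ)) (F1 (ζ t θ)) (F1 (ζ t θ))
    + fderiv ℝ Φ (F (ζ t θ)) (F2 (ζ t θ))
  let k1 : ℝ → ℝ → ℝ := fun t θ => fderiv ℝ Φ (F (ζ t θ)) (F1 (ζ t θ) * Complex.I)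
  let k2 : ℝ → ℝ → ℝ := fun t θ => fderiv ℝ (fderiv ℝ Φ) (F (ζ t θ)) (F1 (ζ t θ) * Complex.I)
      (F1 (ζ t θ) * Complex.I)
    + fderiv ℝ Φ (F (ζ t θ)) (F2 (ζ t θ) * Complex.I * Complex.I)
  have c0 := hGc F hFd
  have c1 := hGc F1 hF1d
  have c2 := hGc F2 hF2d
  have cg0 : ContinuousOn (Function.uncurry g0) (Iio 0 ×ˢ univ) :=
    hΦ.continuous.comp_continuousOn c0
  have cD : ContinuousOn (fun x : ℝ × ℝ => fderiv ℝ Φ (F (Function.uncurry ζ x))) (Iio 0 ×ˢ univ) :=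
    hΦ1c.comp_continuousOn c0
  have cD2 : ContinuousOn (fun x : ℝ × ℝ => fderiv ℝ (fderiv ℝ Φ) (F (Function.uncurry ζ x)))
      (Iio 0 ×ˢ univ) := hΦ2c.comp_continuousOn c0
  have cg1 : ContinuousOn (Function.uncurry g1) (Iio 0 ×ˢ univ) := cD.clm_apply c1
  have cg2 : ContinuousOn (Function.uncurry g2) (Iio 0 ×ˢ univ) :=
    ((cD2.clm_apply c1).clm_apply c1).add (cD.clm_apply c2)
  have c1I := c1.mul (continuousOn_const (c := Complex.I))
  have ck2 : ContinuousOn (Function.uncurry k2) (Iio 0 ×ˢ univ) :=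
    ((cD2.clm_apply c1I).clm_apply c1I).add
      (cD.clm_apply ((c2.mul continuousOn_const).mul continuousOn_const))
  have hslice : ∀ (h : ℝ → ℝ → ℝ), ContinuousOn (Function.uncurry h) (Iio 0 ×ˢ univ) →
      ∀ s < 0, Continuous (h s) := by
    intro h hh s hs
    have : Continuous ((Function.uncurry h) ∘ (fun θ : ℝ => (s, θ))) := by
      rw [← continuousOn_univ]
      refine hh.comp (by fun_prop) ?_
      intro θ _
      exact ⟨hs, mem_univ _⟩
    exact this
  have d0 : ∀ t < 0, ∀ θ, HasDerivAt (fun s => g0 s θ) (g1 t θ) t := by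
    intro t ht θ
    exact hch1 _ _ t (hG1 F hFd t ht θ)
  have d1 : ∀ t < 0, ∀ θ, HasDerivAt (fun s => g1 s θ) (g2 t θ) t := by
    intro t ht θ
    exact hch2 _ _ _ _ t (hG1 F hFd t ht θ) (hG1 F1 hF1d t ht θ)
  have e1 : ∀ t < 0, ∀ θ, HasDerivAt (fun s => k1 t s) (k2 t θ) θ := by
    intro t ht θ
    exact hch2 _ _ _ _ θ (hG2 F hFd t ht θ) ((hG2 F1 hF1d t ht θ).mul_const _)
  have m0 := rz_hasDerivAt_integral g0 g1 cg0 cg1 d0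
  have m1 := rz_hasDerivAt_integral g1 g2 cg1 cg2 d1
  have hF1eq : ∀ z ∈ U, F1 z = deriv f (Complex.exp z) * Complex.exp z := by
    intro z hz
    have h1 := (hf.differentiableAt (Metric.isOpen_ball.mem_nhds (hexp z hz))).hasDerivAt
    exact (h1.comp z (Complex.hasDerivAt_exp z)).deriv
  have hper : ∀ t < 0, k1 t (2*π) = k1 t 0 := by
    intro t ht
    have : Complex.exp (ζ t (2*π)) = Complex.exp (ζ t 0) := by
      simp [ζ, Complex.exp_add]
    simp only [k1, hF, hF1eq _ (hζU t ht _), this]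
  have hk2 : ∀ t < 0, ∫ θ in (0:ℝ)..(2*π), k2 t θ = 0 := by
    intro t ht
    rw [intervalIntegral.integral_eq_sub_of_hasDerivAt (f := k1 t) (fun θ _ => e1 t ht θ)
      ((hslice k2 ck2 t ht).intervalIntegrable _ _), hper t ht, sub_self]
  have hm2 : ∀ t < 0, 0 ≤ ∫ θ in (0:ℝ)..(2*π), g2 t θ := by
    intro t ht
    have : ∫ θ in (0:ℝ)..(2*π), g2 t θ = ∫ θ in (0:ℝ)..(2*π), (g2 t θ + k2 t θ) := by
      rw [intervalIntegral.integral_add ((hslice g2 cg2 t ht).intervalIntegrable _ _)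
        ((hslice k2 ck2 t ht).intervalIntegrable _ _), hk2 t ht, add_zero]
    rw [this]
    refine intervalIntegral.integral_nonneg (by positivity) fun θ _ => ?_
    have h := lap (F (ζ t θ)) (F1 (ζ t θ))
    have h2 : F2 (ζ t θ) * Complex.I * Complex.I = - F2 (ζ t θ) := by
      rw [mul_assoc, Complex.I_mul_I]; ring
    simp only [g2, k2, h2, map_neg]
    linarith
  -- monotonicity
  let M1 : ℝ → ℝ := fun t => ∫ θ in (0:ℝ)..(2*π), g1 t θ
  let M0 : ℝ → ℝ := fun t => ∫ θ in (0:ℝ)..(2*π), g0 t θ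
  have mono : ∀ (H H' : ℝ → ℝ), (∀ t < 0, HasDerivAt H (H' t) t) → (∀ t < 0, 0 ≤ H' t) →
      MonotoneOn H (Iio 0) := by
    intro H H' h1 h2
    refine monotoneOn_of_deriv_nonneg (convex_Iio 0)
      (fun t ht => (h1 t ht).continuousAt.continuousWithinAt) ?_ ?_
    · intro t ht
      rw [interior_Iio] at ht
      exact (h1 t ht).differentiableAt.differentiableWithinAt
    · intro t ht
      rw [interior_Iio] at ht
      rw [(h1 t ht).deriv]; exact h2 t ht
  have lim : ∀ ψ : ℂ → ℝ, ContinuousOn ψ (Metric.ball 0 1) →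
      Filter.Tendsto (fun t : ℝ => ∫ θ in (0:ℝ)..(2*π), ψ (Complex.exp (ζ t θ))) Filter.atBot
        (nhds (2 * π * ψ 0)) := by
    intro ψ hψ
    have h1 : ContinuousOn (circleAverage ψ 0) (Ico 0 1) := by
      refine ContinuousOn.circleAverage (hψ.mono ?_) (fun r hr => hr.1)
      intro z hz
      simpa using hz.2
    have h2 := h1 0 (by simp)
    have h3 : Filter.Tendsto (fun t : ℝ => Real.exp t) Filter.atBot (nhdsWithin 0 (Ico 0 1)) := by
      rw [tendsto_nhdsWithin_iff]
      refine ⟨Real.tendsto_exp_atBot, ?_⟩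
      filter_upwards [Filter.eventually_lt_atBot 0] with t ht
      exact ⟨(Real.exp_pos t).le, by simpa using ht⟩
    have h4 := (h2.tendsto.comp h3).const_mul (2 * π)
    rw [circleAverage_zero] at h4
    refine h4.congr fun t => ?_
    have hpi : (2 * π) ≠ 0 := by positivity
    simp only [Function.comp, circleAverage_def, smul_eq_mul]
    rw [← mul_assoc, mul_inv_cancel₀ hpi, one_mul]
    simp [ζ, circleMap, Complex.exp_add]
  have hM1mono : MonotoneOn M1 (Iio 0) := mono M1 _ m1 hm2
  have hfc : ContinuousOn (deriv f) (Metric.ball 0 1) := (hf.deriv Metric.isOpen_ball).continuousOn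
  have hM1lim : Filter.Tendsto M1 Filter.atBot (nhds 0) := by
    have := lim (fun z => fderiv ℝ Φ (f z) (deriv f z * z))
      ((hΦ1c.comp_continuousOn hf.continuousOn).clm_apply (hfc.mul continuousOn_id))
    simp only [mul_zero, map_zero] at this
    refine this.congr' ?_
    filter_upwards [Filter.eventually_lt_atBot 0] with t ht
    simp only [M1, g1, hF]
    refine intervalIntegral.integral_congr fun θ _ => ?_
    simp only [hF1eq _ (hζU t ht _)]
  have hM1 : ∀ t < 0, 0 ≤ M1 t := by
    intro t ht
    refine le_of_tendsto hM1lim ?_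
    filter_upwards [Filter.eventually_le_atBot t] with s hs
    exact hM1mono (lt_of_le_of_lt hs ht) ht hs
  have hM0mono : MonotoneOn M0 (Iio 0) := mono M0 _ m0 hM1
  have hM0lim : Filter.Tendsto M0 Filter.atBot (nhds (2 * π * Φ (f 0))) :=
    lim (fun z => Φ (f z)) (hΦ.continuous.comp_continuousOn hf.continuousOn)
  have hlog : Real.log r < 0 := Real.log_neg hr0 hr1
  have fin : 2 * π * Φ (f 0) ≤ M0 (Real.log r) := by
    refine le_of_tendsto hM0lim ?_
    filter_upwards [Filter.eventually_le_atBot (Real.log r)] with s hs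
    exact hM0mono (lt_of_le_of_lt hs hlog) hlog hs
  refine fin.trans (le_of_eq ?_)
  refine intervalIntegral.integral_congr fun θ _ => ?_
  simp only [g0, hF, ζ, Complex.exp_add]
  rw [← Complex.ofReal_exp, Real.exp_log hr0]

lemma rz_D2 (Φ : ℂ → ℝ) (hΦ : ContDiff ℝ 2 Φ) (w a : ℂ) (g : ℝ → ℝ) (c : ℝ)
    (h1 : ∀ s : ℝ, HasDerivAt (fun s : ℝ => Φ (w + s * a)) (g s) s) (h2 : HasDerivAt g c 0) :
    fderiv ℝ (fderiv ℝ Φ) w a a = c := by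
  have hΦ1 : ContDiff ℝ 1 (fderiv ℝ Φ) := hΦ.fderiv_right (by norm_num)
  have hΦ0 : Differentiable ℝ Φ := hΦ.differentiable (by norm_num)
  have hΦ1d : Differentiable ℝ (fderiv ℝ Φ) := hΦ1.differentiable (by norm_num)
  have hl : ∀ s : ℝ, HasDerivAt (fun s : ℝ => w + s * a) a s := by
    intro s
    have := ((Complex.ofRealCLM.hasDerivAt (x := s)).mul_const a).const_add w
    exact this.congr_deriv (by simp)
  have hg : g = fun s : ℝ => fderiv ℝ Φ (w + s * a) a := by
    funext s
    have h4 : HasDerivAt (fun s : ℝ => Φ (w + s * a)) (fderiv ℝ Φ (w + s * a) a) s :=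
      (hΦ0 (w + s * a)).hasFDerivAt.comp_hasDerivAt s (hl s)
    exact (h1 s).unique h4
  have h5 : HasDerivAt (fun s : ℝ => fderiv ℝ Φ (w + s * a))
      (fderiv ℝ (fderiv ℝ Φ) (w + (0:ℝ) * a) a) 0 :=
    (hΦ1d (w + (0:ℝ) * a)).hasFDerivAt.comp_hasDerivAt (0:ℝ) (hl 0)
  have h3 := h5.clm_apply (hasDerivAt_const (0:ℝ) a)
  rw [hg] at h2
  have h6 := h2.unique h3
  rw [h6, map_zero, add_zero, Complex.ofReal_zero, zero_mul, add_zero]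

def RzSD (φ : ℝ → ℝ) (v d c : ℝ) : Prop :=
  ∃ g : ℝ → ℝ, (∀ s, HasDerivAt φ (g s) s) ∧ HasDerivAt g c 0 ∧ g 0 = d ∧ φ 0 = v

lemma RzSD.add {φ ψ : ℝ → ℝ} {v d c v' d' c' : ℝ} (h : RzSD φ v d c) (k : RzSD ψ v' d' c') :
    RzSD (fun s => φ s + ψ s) (v + v') (d + d') (c + c') := by
  obtain ⟨g, h1, h2, rfl, rfl⟩ := h
  obtain ⟨g', k1, k2, rfl, rfl⟩ := k
  exact ⟨fun s => g s + g' s, fun s => (h1 s).add (k1 s), h2.add k2, rfl, rfl⟩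

lemma RzSD.mul {φ ψ : ℝ → ℝ} {v d c v' d' c' : ℝ} (h : RzSD φ v d c) (k : RzSD ψ v' d' c') :
    RzSD (fun s => φ s * ψ s) (v * v') (d * v' + v * d') (c * v' + 2 * d * d' + v * c') := by
  obtain ⟨g, h1, h2, rfl, rfl⟩ := h
  obtain ⟨g', k1, k2, rfl, rfl⟩ := k
  refine ⟨fun s => g s * ψ s + φ s * g' s, fun s => (h1 s).mul (k1 s), ?_, rfl, rfl⟩
  have := (h2.mul (k1 0)).add ((h1 0).mul k2)
  refine this.congr_deriv ?_
  ring

lemma RzSD.const (k : ℝ) : RzSD (fun _ => k) k 0 0 :=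
  ⟨fun _ => 0, fun s => hasDerivAt_const s k, hasDerivAt_const _ _, rfl, rfl⟩

lemma RzSD.lin (x a : ℝ) : RzSD (fun s => x + s * a) x a 0 := by
  refine ⟨fun _ => a, fun s => ?_, hasDerivAt_const _ _, rfl, by simp⟩
  simpa using ((hasDerivAt_id s).mul_const a).const_add x

lemma RzSD.rpow {φ : ℝ → ℝ} {v d c : ℝ} (h : RzSD φ v d c) (hpos : ∀ s, 0 < φ s) (q : ℝ) :
    RzSD (fun s => φ s ^ q) (v ^ q) (q * v ^ (q - 1) * d)
      (q * (q - 1) * v ^ (q - 2) * d ^ 2 + q * v ^ (q - 1) * c) := by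
  obtain ⟨g, h1, h2, rfl, rfl⟩ := h
  refine ⟨fun s => q * φ s ^ (q - 1) * g s, fun s => ?_, ?_, rfl, rfl⟩
  · refine ((h1 s).rpow_const (p := q) (Or.inl (hpos s).ne')).congr_deriv ?_
    ring
  · have := (((h1 0).rpow_const (p := q - 1) (Or.inl (hpos 0).ne')).const_mul q).mul h2
    refine this.congr_deriv ?_
    rw [show q - 1 - 1 = q - 2 by ring]
    ring

lemma RzSD.D2 {Φ : ℂ → ℝ} (hΦ : ContDiff ℝ 2 Φ) {w a : ℂ} {v d c : ℝ}
    (h : RzSD (fun s : ℝ => Φ (w + s * a)) v d c) : fderiv ℝ (fderiv ℝ Φ) w a a = c := by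
  obtain ⟨g, h1, h2, -, -⟩ := h
  exact rz_D2 Φ hΦ w a g c h1 h2

noncomputable def rzR (ε : ℝ) (w : ℂ) : ℝ := w.re * w.re + w.im * w.im + ε
noncomputable def rzS (ε : ℝ) (w : ℂ) : ℝ := w.re * w.re + ε

lemma rzR_pos {ε : ℝ} (hε : 0 < ε) (w : ℂ) : 0 < rzR ε w := by
  unfold rzR; nlinarith [mul_self_nonneg w.re, mul_self_nonneg w.im]
lemma rzS_pos {ε : ℝ} (hε : 0 < ε) (w : ℂ) : 0 < rzS ε w := by
  unfold rzS; nlinarith [mul_self_nonneg w.re]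

lemma rz_re_sd (w a : ℂ) : RzSD (fun s : ℝ => (w + s * a).re) w.re a.re 0 := by
  simpa using RzSD.lin w.re a.re
lemma rz_im_sd (w a : ℂ) : RzSD (fun s : ℝ => (w + s * a).im) w.im a.im 0 := by
  simpa using RzSD.lin w.im a.im

lemma rzS_sd (ε : ℝ) (w a : ℂ) : RzSD (fun s : ℝ => rzS ε (w + s * a)) (rzS ε w)
    (2 * (w.re * a.re)) (2 * a.re ^ 2) := by
  unfold rzS
  convert ((rz_re_sd w a).mul (rz_re_sd w a)).add (RzSD.const ε) using 1 <;> ring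

lemma rzR_sd (ε : ℝ) (w a : ℂ) : RzSD (fun s : ℝ => rzR ε (w + s * a)) (rzR ε w)
    (2 * (w.re * a.re + w.im * a.im)) (2 * (a.re ^ 2 + a.im ^ 2)) := by
  unfold rzR
  convert (((rz_re_sd w a).mul (rz_re_sd w a)).add ((rz_im_sd w a).mul (rz_im_sd w a))).add
    (RzSD.const ε) using 1 <;> ring

lemma rz_re_cd : ContDiff ℝ 2 (fun w : ℂ => w.re) := Complex.reCLM.contDiff
lemma rz_im_cd : ContDiff ℝ 2 (fun w : ℂ => w.im) := Complex.imCLM.contDiff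

lemma rzR_cd {ε : ℝ} (hε : 0 < ε) (q : ℝ) : ContDiff ℝ 2 (fun w => rzR ε w ^ q) :=
  ContDiff.rpow_const_of_ne (((rz_re_cd.mul rz_re_cd).add (rz_im_cd.mul rz_im_cd)).add contDiff_const)
    (fun w => (rzR_pos hε w).ne')
lemma rzS_cd {ε : ℝ} (hε : 0 < ε) (q : ℝ) : ContDiff ℝ 2 (fun w => rzS ε w ^ q) :=
  ContDiff.rpow_const_of_ne ((rz_re_cd.mul rz_re_cd).add contDiff_const)
    (fun w => (rzS_pos hε w).ne')

lemma rz_rpow_succ {v : ℝ} (hv : 0 < v) (s t : ℝ) (h : t = s + 1) : v ^ t = v ^ s * v := by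
  rw [h, Real.rpow_add_one hv.ne']

lemma rz_norm_rpow (w : ℂ) (q : ℝ) : ‖w‖ ^ (2 * q) = (w.re * w.re + w.im * w.im) ^ q := by
  rw [Real.rpow_mul (norm_nonneg _), ← Complex.normSq_apply, Complex.normSq_eq_norm_sq]
  norm_num
lemma rz_abs_rpow (x : ℝ) (q : ℝ) : |x| ^ (2 * q) = (x * x) ^ q := by
  rw [Real.rpow_mul (abs_nonneg _)]
  congr 1
  norm_num
  ring

lemma rz_case1 (q : ℝ) (h1 : 1 / 2 < q) (h2 : q ≤ 1) : ∃ A : ℝ, 0 < A ∧ ∀ a δ : ℝ, 0 < δ →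
    ∃ Φ : ℂ → ℝ, ContDiff ℝ 2 Φ ∧ (∀ w a : ℂ, 0 ≤ fderiv ℝ (fderiv ℝ Φ) w a a
      + fderiv ℝ (fderiv ℝ Φ) w (a * Complex.I) (a * Complex.I)) ∧
      (∀ w : ℂ, Φ w + ‖w‖ ^ (2 * q) ≤ A * |w.re| ^ (2 * q) + δ) ∧ -δ ≤ Φ (a : ℂ) := by
  have hq1 : 0 < 2 * q - 1 := by linarith
  have hq0 : 0 < q := by linarith
  set K := 2 / (2 * q - 1) with hK
  have hK0 : 0 < K := by positivity
  have hKm : K * (2 * q - 1) = 2 := by rw [hK]; field_simp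
  have hK1 : 1 ≤ K := by nlinarith
  refine ⟨K, hK0, fun a δ hδ => ?_⟩
  set ε := (δ / K) ^ (1 / q) with hε'
  have hε : 0 < ε := by positivity
  have hεq : K * ε ^ q = δ := by
    rw [hε', ← Real.rpow_mul (by positivity), one_div, inv_mul_cancel₀ hq0.ne', Real.rpow_one]
    field_simp
  have hcd : ContDiff ℝ 2 (fun w => K * rzS ε w ^ q + (-1) * rzR ε w ^ q) :=
    (contDiff_const.mul (rzS_cd hε q)).add (contDiff_const.mul (rzR_cd hε q))
  refine ⟨fun w => K * rzS ε w ^ q + (-1) * rzR ε w ^ q, hcd, ?_, ?_, ?_⟩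
  · intro w b
    have key : ∀ b : ℂ, _ := fun b => RzSD.D2 hcd
      (((RzSD.const K).mul ((rzS_sd ε w b).rpow (fun s => rzS_pos hε _) q)).add
        ((RzSD.const (-1)).mul ((rzR_sd ε w b).rpow (fun s => rzR_pos hε _) q)))
    rw [key, key]
    have hS := rzS_pos hε w
    have hR := rzR_pos hε w
    have eS := rz_rpow_succ hS (q - 2) (q - 1) (by ring)
    have eR := rz_rpow_succ hR (q - 2) (q - 1) (by ring)
    have pS := Real.rpow_pos_of_pos hS (q - 2)
    have pR := Real.rpow_pos_of_pos hR (q - 2)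
    have hle : rzR ε w ^ (q - 1) ≤ rzS ε w ^ (q - 1) := by
      apply Real.rpow_le_rpow_of_nonpos hS _ (by linarith)
      unfold rzR rzS; nlinarith [mul_self_nonneg w.im]
    simp only [Complex.mul_re, Complex.mul_im, Complex.I_re, Complex.I_im]
    set S1 := rzS ε w ^ (q - 1)
    set R1 := rzR ε w ^ (q - 1)
    set S2 := rzS ε w ^ (q - 2)
    set R2 := rzR ε w ^ (q - 2)
    have f1 : S2 * w.re ^ 2 ≤ S1 := by
      rw [eS]; apply mul_le_mul_of_nonneg_left _ pS.le
      unfold rzS; nlinarith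
    have f2 : 0 ≤ R2 * (w.re ^ 2 + w.im ^ 2) := by positivity
    have g1 : 0 ≤ K * (4 * q * (1 - q)) * (S1 - S2 * w.re ^ 2) :=
      mul_nonneg (mul_nonneg hK0.le (mul_nonneg (by linarith) (by linarith))) (by linarith)
    have g2 : 0 ≤ 4 * q * (1 - q) * (R2 * (w.re ^ 2 + w.im ^ 2)) :=
      mul_nonneg (mul_nonneg (by linarith) (by linarith)) f2
    have g3 : 0 ≤ 4 * q * (S1 - R1) := mul_nonneg (by linarith) (by linarith)
    have tot : 0 ≤ (K * (4 * q * (q - 1) * (S2 * w.re ^ 2) + 2 * q * S1)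
        - (4 * q * (q - 1) * (R2 * (w.re ^ 2 + w.im ^ 2)) + 4 * q * R1)) := by
      have : K * (2 * q - 1) * (2 * q * S1) = 2 * (2 * q * S1) := by rw [hKm]
      nlinarith
    have := mul_nonneg tot (show 0 ≤ b.re ^ 2 + b.im ^ 2 by positivity)
    refine this.trans (le_of_eq ?_)
    ring
  · intro w
    rw [rz_norm_rpow, rz_abs_rpow]
    have a1 : (w.re * w.re + w.im * w.im) ^ q ≤ rzR ε w ^ q := by
      apply Real.rpow_le_rpow (by nlinarith [mul_self_nonneg w.re, mul_self_nonneg w.im]) _ hq0.le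
      unfold rzR; linarith
    have a2 : rzS ε w ^ q ≤ (w.re * w.re) ^ q + ε ^ q :=
      Real.rpow_add_le_add_rpow (mul_self_nonneg _) hε.le hq0.le h2
    have := mul_le_mul_of_nonneg_left a2 hK0.le
    show K * rzS ε w ^ q + (-1) * rzR ε w ^ q + _ ≤ _
    nlinarith
  · have : rzR ε (a:ℂ) = rzS ε (a:ℂ) := by simp [rzR, rzS]
    show -δ ≤ K * rzS ε (a:ℂ) ^ q + (-1) * rzR ε (a:ℂ) ^ q
    rw [this]
    have := Real.rpow_pos_of_pos (rzS_pos hε (a:ℂ)) q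
    nlinarith

lemma rz_case2 (q : ℝ) (h1 : 1 ≤ q) : ∃ A : ℝ, 0 < A ∧ ∀ a δ : ℝ, 0 < δ →
    ∃ Φ : ℂ → ℝ, ContDiff ℝ 2 Φ ∧ (∀ w a : ℂ, 0 ≤ fderiv ℝ (fderiv ℝ Φ) w a a
      + fderiv ℝ (fderiv ℝ Φ) w (a * Complex.I) (a * Complex.I)) ∧
      (∀ w : ℂ, Φ w + ‖w‖ ^ (2 * q) ≤ A * |w.re| ^ (2 * q) + δ) ∧ -δ ≤ Φ (a : ℂ) := by
  have hq0 : 0 < q := by linarith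
  set K := 4 * q ^ 2 with hK
  have hK0 : 0 < K := by positivity
  refine ⟨K * K ^ (q - 1), by positivity, fun a δ hδ => ?_⟩
  set T := (a * a + 1) ^ (q - 1) with hT
  have hT0 : 0 < T := Real.rpow_pos_of_pos (by nlinarith [mul_self_nonneg a]) _
  set ε := min 1 (δ / (2 * T)) with hε'
  have hε : 0 < ε := by positivity
  have hε1 : ε ≤ 1 := min_le_left _ _
  have hε2 : 2 * ε * T ≤ δ := by
    have : ε ≤ δ / (2 * T) := min_le_right _ _
    rw [le_div_iff₀ (by positivity)] at this
    linarith
  have hcd : ContDiff ℝ 2 (fun w => K * ((w.re * w.re) * rzR ε w ^ (q - 1)) + (-2) * rzR ε w ^ q) :=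
    (contDiff_const.mul ((rz_re_cd.mul rz_re_cd).mul (rzR_cd hε (q - 1)))).add
      (contDiff_const.mul (rzR_cd hε q))
  refine ⟨fun w => K * ((w.re * w.re) * rzR ε w ^ (q - 1)) + (-2) * rzR ε w ^ q, hcd, ?_, ?_, ?_⟩
  · intro w b
    have key : ∀ b : ℂ, _ := fun b => RzSD.D2 hcd
      (((RzSD.const K).mul (((rz_re_sd w b).mul (rz_re_sd w b)).mul
        ((rzR_sd ε w b).rpow (fun s => rzR_pos hε _) (q - 1)))).add
        ((RzSD.const (-2)).mul ((rzR_sd ε w b).rpow (fun s => rzR_pos hε _) q)))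
    rw [key, key]
    have hR := rzR_pos hε w
    have eR := rz_rpow_succ hR (q - 2) (q - 1) (by ring)
    have eR3 := rz_rpow_succ hR (q - 3) (q - 2) (by ring)
    have pR := Real.rpow_pos_of_pos hR (q - 2)
    have pR3 := Real.rpow_pos_of_pos hR (q - 3)
    simp only [Complex.mul_re, Complex.mul_im, Complex.I_re, Complex.I_im]
    rw [show q - 1 - 1 = q - 2 by ring, show q - 1 - 2 = q - 3 by ring]
    set R1 := rzR ε w ^ (q - 1)
    set R2 := rzR ε w ^ (q - 2)
    set R3 := rzR ε w ^ (q - 3)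
    have hRe : rzR ε w = w.re ^ 2 + w.im ^ 2 + ε := by unfold rzR; ring
    set N := w.re ^ 2 + w.im ^ 2 with hN
    have hN0 : 0 ≤ N := by positivity
    have hq1 : 0 ≤ q - 1 := by linarith
    have f1 : R2 * N ≤ R1 := by
      rw [eR]; apply mul_le_mul_of_nonneg_left _ pR.le
      linarith
    have g1 : 0 ≤ K * (8 * (q - 1) * w.re ^ 2 * R2
        + w.re ^ 2 * (4 * (q - 1)) * R3 * ((q - 1) * N + ε)) := by positivity
    have g2 : 0 ≤ 8 * q * (q - 1) * (R1 - R2 * N) := mul_nonneg (by positivity) (by linarith)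
    have tot : 0 ≤ K * (2 * R1 + 8 * (q - 1) * w.re ^ 2 * R2
        + w.re ^ 2 * (4 * (q - 1)) * R3 * ((q - 1) * N + ε))
        - 2 * (4 * q * (q - 1) * (R2 * N) + 4 * q * R1) := by
      have : K * (2 * R1) = 8 * q ^ 2 * R1 := by rw [hK]; ring
      nlinarith
    have := mul_nonneg tot (show 0 ≤ b.re ^ 2 + b.im ^ 2 by positivity)
    refine this.trans (le_of_eq ?_)
    rw [eR3, hRe, hN]
    ring
  · intro w
    rw [rz_norm_rpow, rz_abs_rpow]
    have a1 : (w.re * w.re + w.im * w.im) ^ q ≤ rzR ε w ^ q := by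
      apply Real.rpow_le_rpow (by nlinarith [mul_self_nonneg w.re, mul_self_nonneg w.im]) _ hq0.le
      unfold rzR; linarith
    have hR := rzR_pos hε w
    have eR := rz_rpow_succ hR (q - 1) q (by ring)
    have pR := Real.rpow_pos_of_pos hR (q - 1)
    have pR' := Real.rpow_pos_of_pos hR q
    have hx := mul_self_nonneg w.re
    show K * ((w.re * w.re) * rzR ε w ^ (q - 1)) + (-2) * rzR ε w ^ q + _ ≤ _
    rcases le_total (K * (w.re * w.re)) (rzR ε w) with hc | hc
    · have b1 : K * ((w.re * w.re) * rzR ε w ^ (q - 1)) ≤ rzR ε w ^ q := by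
        rw [eR, ← mul_assoc, mul_comm (rzR ε w ^ (q - 1))]
        exact mul_le_mul_of_nonneg_right hc pR.le
      have : 0 ≤ K * K ^ (q - 1) * (w.re * w.re) ^ q := by positivity
      linarith
    · have hxp : 0 < w.re * w.re := by
        by_contra hcon
        have : w.re * w.re = 0 := le_antisymm (not_lt.mp hcon) hx
        rw [this] at hc; linarith
      have b1 : rzR ε w ^ (q - 1) ≤ K ^ (q - 1) * (w.re * w.re) ^ (q - 1) := by
        rw [← Real.mul_rpow hK0.le hx]
        exact Real.rpow_le_rpow hR.le hc (by linarith)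
      have b2 := mul_le_mul_of_nonneg_left b1 (mul_nonneg hK0.le hx)
      rw [rz_rpow_succ hxp (q - 1) q (by ring)]
      nlinarith
  · have hR : rzR ε (a:ℂ) = a * a + ε := by simp [rzR]
    have hRp := rzR_pos hε (a:ℂ)
    show -δ ≤ K * (a * a * rzR ε (a:ℂ) ^ (q - 1)) + (-2) * rzR ε (a:ℂ) ^ q
    have eR := rz_rpow_succ hRp (q - 1) q (by ring)
    have pR := Real.rpow_pos_of_pos hRp (q - 1)
    have hle : rzR ε (a:ℂ) ^ (q - 1) ≤ T :=
      Real.rpow_le_rpow hRp.le (by rw [hR]; linarith) (by linarith)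
    rw [eR]
    set P := rzR ε (a:ℂ) ^ (q - 1)
    rw [hR]
    have hK2 : 2 ≤ K := by rw [hK]; nlinarith
    have : 0 ≤ (K - 2) * (a * a * P) := mul_nonneg (by linarith) (mul_nonneg (mul_self_nonneg a) pR.le)
    have h3 : 2 * ε * P ≤ 2 * ε * T := mul_le_mul_of_nonneg_left hle (by linarith)
    nlinarith

lemma rz_case (p : ℝ) (hp : 1 < p) : ∃ A : ℝ, 0 < A ∧ ∀ a δ : ℝ, 0 < δ →
    ∃ Φ : ℂ → ℝ, ContDiff ℝ 2 Φ ∧ (∀ w a : ℂ, 0 ≤ fderiv ℝ (fderiv ℝ Φ) w a a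
      + fderiv ℝ (fderiv ℝ Φ) w (a * Complex.I) (a * Complex.I)) ∧
      (∀ w : ℂ, Φ w + ‖w‖ ^ p ≤ A * |w.re| ^ p + δ) ∧ -δ ≤ Φ (a : ℂ) := by
  have e : p = 2 * (p / 2) := by ring
  rw [e]
  rcases le_total (p / 2) 1 with h | h
  · exact rz_case1 (p / 2) (by linarith) h
  · exact rz_case2 (p / 2) h

theorem riesz_unit_disc (p : ℝ) (hp : 1 < p) :
    ∃ C : ℝ, 0 < C ∧
      ∀ f : ℂ → ℂ, DifferentiableOn ℂ f (Metric.ball 0 1) → (f 0).im = 0 →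
        (⨆ r ∈ Ioo (0:ℝ) 1, ∫⁻ θ in Ioc (0:ℝ) (2 * π),
            ENNReal.ofReal (‖f ((r : ℂ) * Complex.exp (θ * Complex.I))‖ ^ p))
          ≤ ENNReal.ofReal (C ^ p) *
            ⨆ r ∈ Ioo (0:ℝ) 1, ∫⁻ θ in Ioc (0:ℝ) (2 * π),
              ENNReal.ofReal (|(f ((r : ℂ) * Complex.exp (θ * Complex.I))).re| ^ p) := by
  obtain ⟨A, hA, hcase⟩ := rz_case p hp
  have hp0 : 0 < p := by linarith
  refine ⟨A ^ (1 / p), by positivity, fun f hf h0 => ?_⟩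
  rw [← Real.rpow_mul hA.le, one_div, inv_mul_cancel₀ hp0.ne', Real.rpow_one]
  refine iSup₂_le fun r hr => ?_
  refine le_trans ?_ (mul_le_mul_right (le_iSup₂ (f := fun (r : ℝ) (_ : r ∈ Ioo (0:ℝ) 1) =>
    ∫⁻ θ in Ioc (0:ℝ) (2 * π),
      ENNReal.ofReal (|(f ((r : ℂ) * Complex.exp (θ * Complex.I))).re| ^ p)) r hr) _)
  have hc : Continuous (fun θ : ℝ => f ((r : ℂ) * Complex.exp (θ * Complex.I))) := by
    rw [← continuousOn_univ]
    refine hf.continuousOn.comp (by fun_prop) ?_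
    intro θ _
    simp [Complex.norm_exp, abs_of_pos hr.1, hr.2]
  set G : ℝ → ℂ := fun θ : ℝ => f ((r : ℂ) * Complex.exp (θ * Complex.I)) with hG
  have cN : Continuous (fun θ => ‖G θ‖ ^ p) := hc.norm.rpow_const (fun _ => Or.inr hp0.le)
  have cU : Continuous (fun θ => |(G θ).re| ^ p) :=
    (Complex.continuous_re.comp hc).abs.rpow_const (fun _ => Or.inr hp0.le)
  have h2π : (0:ℝ) ≤ 2 * π := by positivity
  have main : ∫ θ in (0:ℝ)..(2*π), ‖G θ‖ ^ p ≤ A * ∫ θ in (0:ℝ)..(2*π), |(G θ).re| ^ p := by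
    refine le_of_forall_pos_le_add fun η hη => ?_
    have hδ : 0 < η / (4 * π) := by positivity
    obtain ⟨Φ, hΦ, lap, hle, ha⟩ := hcase (f 0).re (η / (4 * π)) hδ
    have hf0 : (((f 0).re : ℝ) : ℂ) = f 0 := by
      apply Complex.ext <;> simp [h0]
    rw [hf0] at ha
    have hsub := rz_submean Φ hΦ lap f hf r hr.1 hr.2
    have cΦ : Continuous (fun θ => Φ (G θ)) := hΦ.continuous.comp hc
    have cAU : Continuous (fun θ => A * |(G θ).re| ^ p) := continuous_const.mul cU
    have i1 : ∫ θ in (0:ℝ)..(2*π), (Φ (G θ) + ‖G θ‖ ^ p)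
        ≤ ∫ θ in (0:ℝ)..(2*π), (A * |(G θ).re| ^ p + η / (4 * π)) :=
      intervalIntegral.integral_mono_on h2π ((cΦ.add cN).intervalIntegrable _ _)
        ((cAU.add continuous_const).intervalIntegrable _ _)
        (fun θ _ => hle (G θ))
    rw [intervalIntegral.integral_add (cΦ.intervalIntegrable _ _) (cN.intervalIntegrable _ _),
      intervalIntegral.integral_add (cAU.intervalIntegrable _ _)
        intervalIntegrable_const, intervalIntegral.integral_const_mul,
      intervalIntegral.integral_const] at i1
    have e1 : 2 * π * (η / (4 * π)) = η / 2 := by field_simp; norm_num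
    have e2 : 2 * π * (-(η / (4 * π))) ≤ 2 * π * Φ (f 0) := mul_le_mul_of_nonneg_left ha h2π
    simp only [sub_zero, smul_eq_mul, e1] at i1
    have hsub' : 2 * π * Φ (f 0) ≤ ∫ θ in (0:ℝ)..(2*π), Φ (G θ) := hsub
    linarith
  rw [intervalIntegral.integral_of_le h2π, intervalIntegral.integral_of_le h2π] at main
  rw [← ofReal_integral_eq_lintegral_ofReal, ← ofReal_integral_eq_lintegral_ofReal,
    ← ENNReal.ofReal_mul hA.le]
  · exact ENNReal.ofReal_le_ofReal main
  · exact (intervalIntegrable_iff_integrableOn_Ioc_of_le h2π).1 (cU.intervalIntegrable _ _)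
  · exact Filter.Eventually.of_forall fun θ => by positivity
  · exact (intervalIntegrable_iff_integrableOn_Ioc_of_le h2π).1 (cN.intervalIntegrable _ _)
  · exact Filter.Eventually.of_forall fun θ => by positivity
end

section
/- Let f = u + iv be a holomorphic function on the open unit disc 𝔻 ⊂ ℂ with |u| ≤ 1 on 𝔻 and v(0) = 0. Then for every γ with 0 < γ < π/2 there exists a constant C_γ > 0 (depending only on γ) such that ∫₀^{2π} exp(γ |f(r e^{iθ})|) dθ ≤ C_γ for every 0 < r < 1. -/
open Real MeasureTheory Set

/-- **Zygmund's theorem on the unit disc.**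
If `f = u + iv` is holomorphic on the unit disc with `|u| ≤ 1` and `v 0 = 0`, then for every
`0 < γ < π/2` there is a constant `C_γ > 0` depending only on `γ` with
`∫₀^{2π} exp(γ |f(r e^{iθ})|) dθ ≤ C_γ` for all `0 < r < 1`. -/
theorem zygmund_unit_disc (γ : ℝ) (hγ0 : 0 < γ) (hγ : γ < π / 2) :
    ∃ C : ℝ, 0 < C ∧
      ∀ f : ℂ → ℂ, DifferentiableOn ℂ f (Metric.ball 0 1) →
        (∀ z ∈ Metric.ball (0:ℂ) 1, |(f z).re| ≤ 1) → (f 0).im = 0 →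
        ∀ r : ℝ, 0 < r → r < 1 →
          ∫ θ in (0:ℝ)..(2 * π),
              Real.exp (γ * ‖f ((r : ℂ) * Complex.exp (θ * Complex.I))‖) ≤ C := by
  have hc : 0 < Real.cos γ := Real.cos_pos_of_mem_Ioo ⟨by linarith, hγ⟩
  have hpi := Real.pi_pos
  refine ⟨2 * Real.exp γ / Real.cos γ * (2 * π), by positivity, ?_⟩
  intro f hf hu hv r hr0 hr1
  set H : ℂ → ℂ := fun z => Complex.cos (γ * f z) with hH
  have hHd : DifferentiableOn ℂ H (Metric.ball 0 1) := (hf.const_mul _).ccos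
  have hre : ∀ z, (H z).re = Real.cos (γ * (f z).re) * Real.cosh (γ * (f z).im) := by
    intro z
    have h := Complex.cos_eq (γ * f z)
    simp only [hH]
    rw [h]
    simp only [Complex.re_ofReal_mul, Complex.im_ofReal_mul]
    rw [← Complex.ofReal_cos, ← Complex.ofReal_sin, ← Complex.ofReal_cosh, ← Complex.ofReal_sinh]
    simp only [Complex.sub_re, Complex.mul_re, Complex.mul_im, Complex.ofReal_re,
      Complex.ofReal_im, Complex.I_re, Complex.I_im]
    ring
  have hsub : Metric.closedBall (0:ℂ) |r| ⊆ Metric.ball 0 1 :=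
    Metric.closedBall_subset_ball (by rwa [abs_of_pos hr0])
  have hdc : DiffContOnCl ℂ H (Metric.ball 0 |r|) :=
    (hHd.mono ((Metric.closure_ball_subset_closedBall).trans hsub)).diffContOnCl
  have hmem : ∀ θ : ℝ, (r : ℂ) * Complex.exp (θ * Complex.I) ∈ Metric.ball (0:ℂ) 1 := by
    intro θ
    simp [Complex.norm_exp_ofReal_mul_I, abs_of_pos hr0, hr1]
  have hcm : Continuous fun θ : ℝ => (r : ℂ) * Complex.exp (θ * Complex.I) := by fun_prop
  have hcH : Continuous fun θ : ℝ => H ((r : ℂ) * Complex.exp (θ * Complex.I)) :=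
    hHd.continuousOn.comp_continuous hcm hmem
  have hcf : Continuous fun θ : ℝ => f ((r : ℂ) * Complex.exp (θ * Complex.I)) :=
    hf.continuousOn.comp_continuous hcm hmem
  have havg := hdc.circleAverage
  rw [Real.circleAverage_def] at havg
  simp only [circleMap, zero_add] at havg
  have hint : ∫ θ in (0:ℝ)..(2 * π), (H ((r : ℂ) * Complex.exp (θ * Complex.I))).re
      = 2 * π * (H 0).re := by
    have h1 := Complex.reCLM.intervalIntegral_comp_comm
      (hcH.intervalIntegrable (μ := volume) 0 (2 * π))
    simp only [Complex.reCLM_apply] at h1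
    rw [h1, ← havg, Complex.smul_re, smul_eq_mul, ← mul_assoc, mul_inv_cancel₀ (by positivity),
      one_mul]
  have hH0 : (H 0).re ≤ 1 := by
    rw [hre, hv]; simpa using Real.cos_le_one _
  have hpt : ∀ θ : ℝ, Real.exp (γ * ‖f ((r : ℂ) * Complex.exp (θ * Complex.I))‖) ≤
      2 * Real.exp γ / Real.cos γ * (H ((r : ℂ) * Complex.exp (θ * Complex.I))).re := by
    intro θ
    have h1 := hu _ (hmem θ)
    rw [hre]
    generalize f ((r : ℂ) * Complex.exp (θ * Complex.I)) = w at h1 ⊢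
    have h2 : Real.cos γ ≤ Real.cos (γ * w.re) := by
      rw [← Real.cos_abs (γ * w.re), abs_mul, abs_of_pos hγ0]
      apply Real.cos_le_cos_of_nonneg_of_le_pi (by positivity) (by linarith)
      nlinarith
    have h3 : Real.exp (γ * |w.im|) ≤ 2 * Real.cosh (γ * w.im) := by
      rw [← Real.cosh_abs (γ * w.im), abs_mul, abs_of_pos hγ0, Real.cosh_eq]
      have := Real.exp_pos (-(γ * |w.im|))
      linarith
    have h4 : Real.exp (γ * ‖w‖) ≤ Real.exp γ * Real.exp (γ * |w.im|) := by
      rw [← Real.exp_add]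
      apply Real.exp_le_exp.2
      have := Complex.norm_le_abs_re_add_abs_im w
      nlinarith
    calc _ ≤ Real.exp γ * (2 * Real.cosh (γ * w.im)) := h4.trans (by gcongr)
      _ = 2 * Real.exp γ / Real.cos γ * (Real.cos γ * Real.cosh (γ * w.im)) := by field_simp
      _ ≤ _ := by
        have := Real.cosh_pos (γ * w.im)
        gcongr
  calc _ ≤ ∫ θ in (0:ℝ)..(2 * π),
        2 * Real.exp γ / Real.cos γ * (H ((r : ℂ) * Complex.exp (θ * Complex.I))).re := by
        apply intervalIntegral.integral_mono_on (by positivity)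
        · exact (Real.continuous_exp.comp (continuous_const.mul hcf.norm)).intervalIntegrable _ _
        · exact (continuous_const.mul (Complex.continuous_re.comp hcH)).intervalIntegrable _ _
        · intro θ _
          exact hpt θ
    _ = 2 * Real.exp γ / Real.cos γ * (2 * π * (H 0).re) := by
        rw [intervalIntegral.integral_const_mul, hint]
    _ ≤ _ := by
        apply mul_le_mul_of_nonneg_left _ (by positivity)
        nlinarith
end
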